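/- arXiv:1002.3236 — 4 statements merged into one kernel-verified Lean document; each statement's English description precedes it below -/
import Mathlib

section
/- Let V be a real inner product space with 2 ≤ dim V < ∞, and let a₁, a₂, a₃, b₁, b₂, b₃, c₁, c₂, c₃, d₁, d₂, d₃ : [0,∞) → ℝ satisfy, for all t ≥ 0, a₁(t)a₂(t) = 1 + a₃(t)² and (a₁(t) + 2t·b₁(t))(a₂(t) + 2t·b₂(t)) = 1 + (a₃(t) + 2t·b₃(t))². For y ∈ V with t = (1/2)⟪y,y⟫, let J_y : V × V → V × V be defined by J_y(X^H) = a₁(t)X^V + b₁(t)⟪X,y⟫y^V − a₃(t)X^H − b₃(t)⟪X,y⟫y^H and J_y(X^V) = a₃(t)X^V + b₃(t)⟪X,y⟫y^V − a₂(t)X^H − b₂(t)⟪X,y⟫y^H, and let G_y be the symmetric bilinear form on V × V determined by G_y(X^H,Y^H) = c₁(t)⟪X,Y⟫ + d₁(t)⟪X,y⟫⟪Y,y⟫, G_y(X^V,Y^V) = c₂(t)⟪X,Y⟫ + d₂(t)⟪X,y⟫⟪Y,y⟫, and G_y(X^V,Y^H) = c₃(t)⟪X,Y⟫ + d₃(t)⟪X,y⟫⟪Y,y⟫.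 Then G_y(J_y U, J_y W) = −G_y(U, W) for all y ∈ V and all U, W ∈ V × V if and only if for every t ≥ 0: a₂(t)c₁(t) + a₁(t)c₂(t) = 2a₃(t)c₃(t) and (a₂(t) + 2t·b₂(t))(c₁(t) + 2t·d₁(t)) + (a₁(t) + 2t·b₁(t))(c₂(t) + 2t·d₂(t)) = 2(a₃(t) + 2t·b₃(t))(c₃(t) + 2t·d₃(t)). -/
open RealInnerProductSpace

variable {V : Type*} [NormedAddCommGroup V] [InnerProductSpace ℝ V]

/-- The fiberwise form of the general natural almost complex structure `J` on
`TM` (with `a₄ = −a₃`, `b₄ = −b₃`), under the identification of the tangent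
space to `TM` at `y` with `V × V` via `X^H = (X, 0)`, `X^V = (0, X)`, and with
`t = ⟪y,y⟫/2`:
`J_y X^H = a₁(t) X^V + b₁(t) ⟪X,y⟫ y^V − a₃(t) X^H − b₃(t) ⟪X,y⟫ y^H`,
`J_y X^V = a₃(t) X^V + b₃(t) ⟪X,y⟫ y^V − a₂(t) X^H − b₂(t) ⟪X,y⟫ y^H`. -/
noncomputable def genNatJ (a₁ a₂ a₃ b₁ b₂ b₃ : ℝ → ℝ) (y : V) (W : V × V) : V × V :=
  let t : ℝ := ⟪y, y⟫ / 2
  (-(a₃ t) • W.1 - (b₃ t * ⟪W.1, y⟫) • y - a₂ t • W.2 - (b₂ t * ⟪W.2, y⟫) • y,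
   a₁ t • W.1 + (b₁ t * ⟪W.1, y⟫) • y + a₃ t • W.2 + (b₃ t * ⟪W.2, y⟫) • y)

/-- The fiberwise form of the general natural semi-Riemannian metric `G` on
`TM`: the symmetric bilinear form on `V × V` determined by
`G_y(X^H, Y^H) = c₁(t) ⟪X,Y⟫ + d₁(t) ⟪X,y⟫ ⟪Y,y⟫`,
`G_y(X^V, Y^V) = c₂(t) ⟪X,Y⟫ + d₂(t) ⟪X,y⟫ ⟪Y,y⟫`,
`G_y(X^V, Y^H) = c₃(t) ⟪X,Y⟫ + d₃(t) ⟪X,y⟫ ⟪Y,y⟫`, with `t = ⟪y,y⟫/2`. -/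
noncomputable def genNatG (c₁ c₂ c₃ d₁ d₂ d₃ : ℝ → ℝ) (y : V) (U W : V × V) : ℝ :=
  let t : ℝ := ⟪y, y⟫ / 2
  c₁ t * ⟪U.1, W.1⟫ + d₁ t * ⟪U.1, y⟫ * ⟪W.1, y⟫ +
  c₂ t * ⟪U.2, W.2⟫ + d₂ t * ⟪U.2, y⟫ * ⟪W.2, y⟫ +
  c₃ t * (⟪U.2, W.1⟫ + ⟪U.1, W.2⟫) +
  d₃ t * (⟪U.2, y⟫ * ⟪W.1, y⟫ + ⟪U.1, y⟫ * ⟪W.2, y⟫)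

/-- A real inner product space of dimension at least two contains, for every `t ≥ 0`, a vector
of squared norm `2 * t` together with a unit vector orthogonal to it. -/
theorem exists_inner_self_and_orthogonal_unit [FiniteDimensional ℝ V]
    (hdim : 2 ≤ Module.finrank ℝ V) {t : ℝ} (ht : 0 ≤ t) :
    ∃ x y : V, ⟪y, y⟫ = 2 * t ∧ ⟪x, x⟫ = (1 : ℝ) ∧ ⟪x, y⟫ = (0 : ℝ) := by
  let e := stdOrthonormalBasis ℝ V
  let i : Fin (Module.finrank ℝ V) := ⟨0, by omega⟩
  let j : Fin (Module.finrank ℝ V) := ⟨1, by omega⟩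
  have hij : j ≠ i := by simp [i, j]
  refine ⟨e j, √(2 * t) • e i, ?_, ?_, ?_⟩
  · rw [real_inner_smul_left, real_inner_smul_right, real_inner_self_eq_norm_sq,
      e.orthonormal.1 i, one_pow, mul_one, Real.mul_self_sqrt (by positivity)]
  · rw [real_inner_self_eq_norm_sq, e.orthonormal.1 j, one_pow]
  · rw [real_inner_smul_right, e.orthonormal.2 hij, mul_zero]

/-- A factor of a number of the form `1 + r ^ 2` can be cancelled. -/
theorem eq_zero_of_mul_eq_zero_of_mul_eq_one_add_sq {p q r z : ℝ} (h : p * q = 1 + r ^ 2)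
    (hz : p * z = 0) : z = 0 := by
  refine (mul_eq_zero.mp hz).resolve_left ?_
  rintro rfl
  nlinarith [sq_nonneg r]

/-- Fiberwise content of the theorem characterizing the almost anti-Hermitian
(Norden) structures `(G, J)` of general natural lift type on `TM`:  given the
relations making `J` an almost complex structure, `G_y(J_y U, J_y W) = −G_y(U, W)`
holds for all `y, U, W` iff `a₂ c₁ + a₁ c₂ = 2 a₃ c₃` and
`(a₂ + 2tb₂)(c₁ + 2td₁) + (a₁ + 2tb₁)(c₂ + 2td₂) = 2(a₃ + 2tb₃)(c₃ + 2td₃)`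
for every `t ≥ 0`. -/
theorem genNat_anti_hermitian_iff
    [FiniteDimensional ℝ V] (hdim : 2 ≤ Module.finrank ℝ V)
    (a₁ a₂ a₃ b₁ b₂ b₃ c₁ c₂ c₃ d₁ d₂ d₃ : ℝ → ℝ)
    (hJ₁ : ∀ t : ℝ, 0 ≤ t → a₁ t * a₂ t = 1 + (a₃ t) ^ 2)
    (hJ₂ : ∀ t : ℝ, 0 ≤ t →
      (a₁ t + 2 * t * b₁ t) * (a₂ t + 2 * t * b₂ t)
        = 1 + (a₃ t + 2 * t * b₃ t) ^ 2) :
    (∀ y : V, ∀ U W : V × V,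
        genNatG c₁ c₂ c₃ d₁ d₂ d₃ y
            (genNatJ a₁ a₂ a₃ b₁ b₂ b₃ y U) (genNatJ a₁ a₂ a₃ b₁ b₂ b₃ y W)
          = -genNatG c₁ c₂ c₃ d₁ d₂ d₃ y U W)
      ↔
    (∀ t : ℝ, 0 ≤ t →
        a₂ t * c₁ t + a₁ t * c₂ t = 2 * a₃ t * c₃ t ∧
        (a₂ t + 2 * t * b₂ t) * (c₁ t + 2 * t * d₁ t) +
            (a₁ t + 2 * t * b₁ t) * (c₂ t + 2 * t * d₂ t)
          = 2 * (a₃ t + 2 * t * b₃ t) * (c₃ t + 2 * t * d₃ t)) := by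
  constructor
  · intro h t ht
    obtain ⟨x, y, hyy, hxx, hxy⟩ := exists_inner_self_and_orthogonal_unit hdim ht
    have hyx : ⟪y, x⟫ = (0 : ℝ) := by rw [real_inner_comm, hxy]
    have hty : 2 * t / 2 = t := by ring
    have hperp : a₂ t * c₁ t + a₁ t * c₂ t - 2 * a₃ t * c₃ t = 0 := by
      apply eq_zero_of_mul_eq_zero_of_mul_eq_one_add_sq (hJ₁ t ht)
      have hx := h y (x, 0) (x, 0)
      simp only [genNatG, genNatJ, hty, inner_add_left, inner_add_right, inner_sub_left,
        inner_sub_right, real_inner_smul_left, real_inner_smul_right, inner_zero_left,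
        inner_zero_right, hyy, hxx, hxy, hyx] at hx
      linear_combination hx + c₁ t * hJ₁ t ht
    refine ⟨sub_eq_zero.mp hperp, ?_⟩
    rcases ht.eq_or_lt with rfl | htpos
    · linear_combination hperp
    · refine sub_eq_zero.mp (eq_zero_of_mul_eq_zero_of_mul_eq_one_add_sq (hJ₂ t ht) ?_)
      have hy := h y (y, 0) (y, 0)
      simp only [genNatG, genNatJ, hty, inner_add_left, inner_add_right, inner_sub_left,
        inner_sub_right, real_inner_smul_left, real_inner_smul_right, inner_zero_left,
        inner_zero_right, hyy] at hy
      apply mul_left_cancel₀ (mul_pos two_pos htpos).ne'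
      linear_combination hy + 2 * t * (c₁ t + 2 * t * d₁ t) * hJ₂ t ht
  · rintro h y ⟨X, Y⟩ ⟨Z, W⟩
    have ht : (0 : ℝ) ≤ ⟪y, y⟫ / 2 := div_nonneg real_inner_self_nonneg two_pos.le
    obtain ⟨hperp, hrad⟩ := h _ ht
    have hJperp := hJ₁ _ ht
    have hJrad := hJ₂ _ ht
    by_cases hy : y = 0
    · subst hy
      simp only [genNatG, genNatJ, inner_add_left, inner_add_right, inner_sub_left,
        inner_sub_right, real_inner_smul_left, real_inner_smul_right, inner_zero_left,
        inner_zero_right, smul_zero, zero_div] at hperp hJperp ⊢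
      linear_combination
        (a₁ 0 * ⟪X, Z⟫ + a₂ 0 * ⟪Y, W⟫ + a₃ 0 * (⟪Y, Z⟫ + ⟪X, W⟫)) * hperp
          - (c₁ 0 * ⟪X, Z⟫ + c₂ 0 * ⟪Y, W⟫ + c₃ 0 * (⟪Y, Z⟫ + ⟪X, W⟫)) * hJperp
    · have hyy : (⟪y, y⟫ : ℝ) ≠ 0 := inner_self_ne_zero.mpr hy
      obtain ⟨t, hyt⟩ : ∃ t : ℝ, ⟪y, y⟫ = 2 * t := ⟨⟪y, y⟫ / 2, by ring⟩
      have hty : 2 * t / 2 = t := by ring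
      apply mul_left_cancel₀ hyy
      rw [hyt, hty] at hperp hrad hJperp hJrad
      simp only [genNatG, genNatJ, hty, inner_add_left, inner_add_right, inner_sub_left,
        inner_sub_right, real_inner_smul_left, real_inner_smul_right, hyt,
        real_inner_comm _ y]
      linear_combination
        (a₁ t * (2 * t * ⟪X, Z⟫ - ⟪X, y⟫ * ⟪Z, y⟫) + a₂ t * (2 * t * ⟪Y, W⟫ - ⟪Y, y⟫ * ⟪W, y⟫)
          + a₃ t * (2 * t * (⟪Y, Z⟫ + ⟪X, W⟫) - (⟪Y, y⟫ * ⟪Z, y⟫ + ⟪X, y⟫ * ⟪W, y⟫))) * hperp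
        - (c₁ t * (2 * t * ⟪X, Z⟫ - ⟪X, y⟫ * ⟪Z, y⟫) + c₂ t * (2 * t * ⟪Y, W⟫ - ⟪Y, y⟫ * ⟪W, y⟫)
          + c₃ t * (2 * t * (⟪Y, Z⟫ + ⟪X, W⟫)
            - (⟪Y, y⟫ * ⟪Z, y⟫ + ⟪X, y⟫ * ⟪W, y⟫))) * hJperp
        + ((a₁ t + 2 * t * b₁ t) * (⟪X, y⟫ * ⟪Z, y⟫) + (a₂ t + 2 * t * b₂ t) * (⟪Y, y⟫ * ⟪W, y⟫)
          + (a₃ t + 2 * t * b₃ t) * (⟪Y, y⟫ * ⟪Z, y⟫ + ⟪X, y⟫ * ⟪W, y⟫)) * hrad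
        - ((c₁ t + 2 * t * d₁ t) * (⟪X, y⟫ * ⟪Z, y⟫) + (c₂ t + 2 * t * d₂ t) * (⟪Y, y⟫ * ⟪W, y⟫)
          + (c₃ t + 2 * t * d₃ t) * (⟪Y, y⟫ * ⟪Z, y⟫ + ⟪X, y⟫ * ⟪W, y⟫)) * hJrad
end

section
/- Let V be a real inner product space with 1 ≤ dim V < ∞, let y ∈ V, set t = (1/2)⟪y,y⟫, and let c₁, c₂, c₃, d₁, d₂, d₃ ∈ ℝ. Define the symmetric bilinear form G_y on V × V by G_y(X^H,Y^H) = c₁⟪X,Y⟫ + d₁⟪X,y⟫⟪Y,y⟫, G_y(X^V,Y^V) = c₂⟪X,Y⟫ + d₂⟪X,y⟫⟪Y,y⟫, and G_y(X^V,Y^H) = c₃⟪X,Y⟫ + d₃⟪X,y⟫⟪Y,y⟫. If c₁c₂ − c₃² ≠ 0 and (c₁ + 2t·d₁)(c₂ + 2t·d₂) − (c₃ + 2t·d₃)² ≠ 0, then G_y is nondegenerate on V × V. -/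
open RealInnerProductSpace

variable {V : Type*} [NormedAddCommGroup V] [InnerProductSpace ℝ V]

/-- The fiberwise form of the general natural first-order lift `G` of `g` to
`TM` at a fixed tangent vector `y`, with constant coefficients: the symmetric
bilinear form on `V × V` determined by
`G_y(X^H, Y^H) = c₁ ⟪X,Y⟫ + d₁ ⟪X,y⟫ ⟪Y,y⟫`,
`G_y(X^V, Y^V) = c₂ ⟪X,Y⟫ + d₂ ⟪X,y⟫ ⟪Y,y⟫`,
`G_y(X^V, Y^H) = c₃ ⟪X,Y⟫ + d₃ ⟪X,y⟫ ⟪Y,y⟫`,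
under the identification `X^H = (X, 0)`, `X^V = (0, X)`. -/
def fiberG (c₁ c₂ c₃ d₁ d₂ d₃ : ℝ) (y : V) (U W : V × V) : ℝ :=
  c₁ * ⟪U.1, W.1⟫ + d₁ * ⟪U.1, y⟫ * ⟪W.1, y⟫ +
  c₂ * ⟪U.2, W.2⟫ + d₂ * ⟪U.2, y⟫ * ⟪W.2, y⟫ +
  c₃ * (⟪U.2, W.1⟫ + ⟪U.1, W.2⟫) +
  d₃ * (⟪U.2, y⟫ * ⟪W.1, y⟫ + ⟪U.1, y⟫ * ⟪W.2, y⟫)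

/-- A symmetric `2 × 2` linear system with nonzero determinant has only the trivial solution. -/
theorem eq_zero_and_eq_zero_of_symm_det_ne_zero {R : Type*} [CommRing R] [NoZeroDivisors R]
    {a b c p q : R} (hdet : a * b - c ^ 2 ≠ 0)
    (h : a * p + c * q = 0) (h' : c * p + b * q = 0) : p = 0 ∧ q = 0 := by
  constructor
  · refine (mul_eq_zero.mp ?_).resolve_left hdet
    linear_combination b * h - c * h'
  · refine (mul_eq_zero.mp ?_).resolve_left hdet
    linear_combination a * h' - c * h

/-- The paper's sufficient condition for nondegeneracy of the general natural
metric `G`: if `c₁ c₂ − c₃² ≠ 0` and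
`(c₁ + 2td₁)(c₂ + 2td₂) − (c₃ + 2td₃)² ≠ 0`, where `t = ⟪y,y⟫/2` is the
energy density, then `G_y` is nondegenerate on `V × V`. -/
theorem fiberG_nondegenerate
    [FiniteDimensional ℝ V] (hdim : 1 ≤ Module.finrank ℝ V)
    (y : V) (c₁ c₂ c₃ d₁ d₂ d₃ : ℝ)
    (h₁ : c₁ * c₂ - c₃ ^ 2 ≠ 0)
    (h₂ : (c₁ + 2 * (⟪y, y⟫ / 2) * d₁) * (c₂ + 2 * (⟪y, y⟫ / 2) * d₂)
        - (c₃ + 2 * (⟪y, y⟫ / 2) * d₃) ^ 2 ≠ 0) :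
    ∀ U : V × V, (∀ W : V × V, fiberG c₁ c₂ c₃ d₁ d₂ d₃ y U W = 0) → U = 0 := by
  rintro ⟨A, B⟩ h
  have horizontal (w : V) :
      c₁ * ⟪A, w⟫ + c₃ * ⟪B, w⟫ + (d₁ * ⟪A, y⟫ + d₃ * ⟪B, y⟫) * ⟪w, y⟫ = 0 := by
    have := h (w, 0)
    simp only [fiberG, inner_zero_left, inner_zero_right] at this
    linear_combination this
  have vertical (w : V) :
      c₃ * ⟪A, w⟫ + c₂ * ⟪B, w⟫ + (d₃ * ⟪A, y⟫ + d₂ * ⟪B, y⟫) * ⟪w, y⟫ = 0 := by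
    have := h (0, w)
    simp only [fiberG, inner_zero_left, inner_zero_right] at this
    linear_combination this
  obtain ⟨hA, hB⟩ : ⟪A, y⟫ = 0 ∧ ⟪B, y⟫ = 0 := by
    apply eq_zero_and_eq_zero_of_symm_det_ne_zero h₂
    · linear_combination horizontal y
    · linear_combination vertical y
  have orthogonal (w : V) : ⟪A, w⟫ = 0 ∧ ⟪B, w⟫ = 0 := by
    apply eq_zero_and_eq_zero_of_symm_det_ne_zero h₁
    · simpa [hA, hB] using horizontal w
    · simpa [hA, hB] using vertical w
  exact Prod.ext (inner_self_eq_zero.mp (orthogonal A).1)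
    (inner_self_eq_zero.mp (orthogonal B).2)
end

section
/- Let c ∈ ℝ, let A and B be real constants with A ≠ 0 and B > 0, and let I = {t ∈ [0,∞) : B + 2ct > 0}. Define a₁, b₁, c₁, d₁ : I → ℝ by a₁(t) = √(B + 2ct), b₁(t) = 0, c₁(t) = A(B + 2ct), and d₁(t) = −cA. Then for every t ∈ I: a₁(t) > 0, a₁(t)² ≠ 2ct, a₁ is differentiable at t with a₁(t) − 2t·a₁'(t) ≠ 0 and b₁(t) = (a₁(t)a₁'(t) − c)/(a₁(t) − 2t·a₁'(t)), c₁ is differentiable at t with c₁'(t) = 2c·c₁(t)·(a₁(t) − 2a₁'(t)t)/(a₁(t)(a₁(t)² − 2ct)), and d₁(t) = −c·c₁(t)/a₁(t)². Moreover, if c < 0 then I = [0, −B/(2c)), while if c ≥ 0 then I = [0,∞). -/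
/-- Case 2 of the paper's theorem on natural diagonal anti-Kähler tangent
bundles (verification): for a base manifold of constant sectional curvature
`c`, the explicit coefficients `a₁ = √(B + 2ct)`, `b₁ = 0`, `c₁ = A(B + 2ct)`,
`d₁ = −cA` (with `A ≠ 0`, `B > 0`) satisfy, on
`I = {t ∈ [0,∞) : B + 2ct > 0}`, the anti-Kähler system
`b₁ = (a₁a₁' − c)/(a₁ − 2ta₁')`,
`c₁' = 2cc₁(a₁ − 2a₁'t)/(a₁(a₁² − 2ct))`, `d₁ = −cc₁/a₁²`, with `a₁ > 0` and
`a₁² ≠ 2ct`; moreover `I = [0, −B/(2c))` if `c < 0` and `I = [0,∞)` if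
`c ≥ 0`. -/
theorem natural_diagonal_antiKahler_example
    (c A B : ℝ) (hA : A ≠ 0) (hB : 0 < B) :
    let I : Set ℝ := {t | 0 ≤ t ∧ 0 < B + 2 * c * t}
    let a₁ : ℝ → ℝ := fun t => Real.sqrt (B + 2 * c * t)
    let b₁ : ℝ → ℝ := fun _ => 0
    let c₁ : ℝ → ℝ := fun t => A * (B + 2 * c * t)
    let d₁ : ℝ → ℝ := fun _ => -c * A
    (∀ t ∈ I,
        0 < a₁ t ∧
        (a₁ t) ^ 2 ≠ 2 * c * t ∧
        DifferentiableAt ℝ a₁ t ∧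
        a₁ t - 2 * t * deriv a₁ t ≠ 0 ∧
        b₁ t = (a₁ t * deriv a₁ t - c) / (a₁ t - 2 * t * deriv a₁ t) ∧
        DifferentiableAt ℝ c₁ t ∧
        deriv c₁ t = 2 * c * c₁ t * (a₁ t - 2 * deriv a₁ t * t) /
          (a₁ t * ((a₁ t) ^ 2 - 2 * c * t)) ∧
        d₁ t = -c * c₁ t / (a₁ t) ^ 2) ∧
    (c < 0 → I = Set.Ico 0 (-B / (2 * c))) ∧
    (0 ≤ c → I = Set.Ici 0) := by
  intro I a₁ b₁ c₁ d₁
  refine ⟨?_, ?_, ?_⟩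
  · rintro t ⟨-, hpos⟩
    have ha : 0 < a₁ t := Real.sqrt_pos.mpr hpos
    have hsq : a₁ t ^ 2 = B + 2 * c * t := Real.sq_sqrt hpos.le
    have hlin : HasDerivAt (fun s : ℝ => B + 2 * c * s) (2 * c) t := by
      simpa using ((hasDerivAt_id t).const_mul (2 * c)).const_add B
    have hda : HasDerivAt a₁ (c / a₁ t) t := by
      convert hlin.sqrt hpos.ne' using 1
      exact (mul_div_mul_left c (a₁ t) two_ne_zero).symm
    have hdc : HasDerivAt c₁ (A * (2 * c)) t := hlin.const_mul A
    have hc₁ : c₁ t = A * a₁ t ^ 2 := by rw [hsq]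
    have hB' : a₁ t ^ 2 - 2 * c * t = B := by rw [hsq]; ring
    have hden : a₁ t - 2 * t * (c / a₁ t) = B / a₁ t := by
      rw [← hB']
      field_simp
    have hden' : a₁ t - 2 * (c / a₁ t) * t = B / a₁ t := by
      rw [← hden]
      ring
    rw [hda.deriv, hdc.deriv, hden, hden', hB', hc₁]
    refine ⟨ha, ?_, hda.differentiableAt, (div_pos hB ha).ne', ?_,
      hdc.differentiableAt, ?_, ?_⟩
    · intro h
      linarith
    · rw [mul_div_cancel₀ c ha.ne', sub_self, zero_div]
    · field_simp
    · change -c * A = _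
      field_simp
  · intro hc
    ext t
    simp only [I, Set.mem_ofPred_eq, Set.mem_Ico, and_congr_right_iff]
    intro _
    rw [lt_div_iff_of_neg (by linarith)]
    constructor <;> intro h <;> linarith
  · intro hc
    ext t
    simp only [I, Set.mem_ofPred_eq, Set.mem_Ici, and_iff_left_iff_imp]
    intro ht
    positivity
end

section
/- Let c ∈ ℝ, let B > 0, and let I = {t ∈ [0,∞) : B + 2ct > 0}. Suppose a₁, c₁ : I → ℝ are differentiable with a₁(t) > 0 for all t ∈ I, a₁(0) = √B, and suppose that for every t ∈ I: a₁(t)·a₁'(t) = c and c₁'(t) = 2c·c₁(t)·(a₁(t) − 2a₁'(t)t)/(a₁(t)(a₁(t)² − 2ct)), where a₁(t)² ≠ 2ct. Then for all t ∈ I: a₁(t) = √(B + 2ct) and c₁(t) = (c₁(0)/B)·(B + 2ct); consequently the function d₁ := −c·c₁/a₁² is constant, equal to −c·c₁(0)/B. -/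
theorem eq_left_of_hasDerivAt_zero {f : ℝ → ℝ} {a b : ℝ} (hab : a ≤ b)
    (hf : ∀ x ∈ Set.Icc a b, HasDerivAt f 0 x) : f b = f a :=
  constant_of_has_deriv_right_zero
    (fun x hx => (hf x hx).continuousAt.continuousWithinAt)
    (fun x hx => (hf x (Set.Ico_subset_Icc_self hx)).hasDerivWithinAt) b
    (Set.right_mem_Icc.2 hab)

/-- Uniqueness part of case 2 of the paper's theorem on natural diagonal
anti-Kähler tangent bundles: for a base manifold of constant sectional
curvature `c`, if the coefficients `a₁, c₁` (functions of the energy density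
`t` on `I = {t ∈ [0,∞) : B + 2ct > 0}`) are differentiable with `a₁ > 0`,
`a₁(0) = √B`, `a₁ a₁' = c` (i.e. `b₁ = 0`) and
`c₁' = 2cc₁(a₁ − 2a₁'t)/(a₁(a₁² − 2ct))` with `a₁² ≠ 2ct`, then necessarily
`a₁ = √(B + 2ct)` and `c₁ = (c₁(0)/B)(B + 2ct)`, so that `d₁ = −cc₁/a₁²` is
the constant `−c c₁(0)/B`. -/
theorem natural_diagonal_antiKahler_uniqueness
    (c B : ℝ) (hB : 0 < B)
    (a₁ c₁ : ℝ → ℝ)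
    (I : Set ℝ) (hI : I = {t | 0 ≤ t ∧ 0 < B + 2 * c * t})
    (ha_diff : ∀ t ∈ I, DifferentiableAt ℝ a₁ t)
    (hc_diff : ∀ t ∈ I, DifferentiableAt ℝ c₁ t)
    (ha_pos : ∀ t ∈ I, 0 < a₁ t)
    (ha0 : a₁ 0 = Real.sqrt B)
    (hode_a : ∀ t ∈ I, a₁ t * deriv a₁ t = c)
    (hne : ∀ t ∈ I, (a₁ t) ^ 2 ≠ 2 * c * t)
    (hode_c : ∀ t ∈ I, deriv c₁ t =
        2 * c * c₁ t * (a₁ t - 2 * deriv a₁ t * t) /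
          (a₁ t * ((a₁ t) ^ 2 - 2 * c * t))) :
    (∀ t ∈ I, a₁ t = Real.sqrt (B + 2 * c * t)) ∧
    (∀ t ∈ I, c₁ t = (c₁ 0 / B) * (B + 2 * c * t)) ∧
    (∀ t ∈ I, -c * c₁ t / (a₁ t) ^ 2 = -c * c₁ 0 / B) := by
  have hmem : ∀ t ∈ I, ∀ s ∈ Set.Icc 0 t, s ∈ I := by
    subst hI
    rintro t ⟨-, ht⟩ s ⟨hs0, hst⟩
    refine ⟨hs0, ?_⟩
    rcases le_total 0 c with hc | hc
    · positivity
    · nlinarith [mul_nonneg_of_nonpos_of_nonpos hc (sub_nonpos.2 hst)]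
  have hI0 : ∀ t ∈ I, 0 ≤ t := by
    subst hI
    exact fun t ht => ht.1
  have hB0 : a₁ 0 ^ 2 = B := by rw [ha0, Real.sq_sqrt hB.le]
  have hsq : ∀ t ∈ I, a₁ t ^ 2 = B + 2 * c * t := by
    intro t ht
    have h := eq_left_of_hasDerivAt_zero (f := fun x => a₁ x ^ 2 - 2 * c * x) (hI0 t ht) (by
      intro s hs
      have hs' := hmem t ht s hs
      refine (((ha_diff s hs').hasDerivAt.pow 2).sub
        ((hasDerivAt_id s).const_mul (2 * c))).congr_deriv ?_
      norm_num
      linear_combination 2 * hode_a s hs')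
    simp only [hB0] at h
    linarith
  have hquot : ∀ t ∈ I, c₁ t / a₁ t ^ 2 = c₁ 0 / B := by
    intro t ht
    have h := eq_left_of_hasDerivAt_zero (f := fun x => c₁ x / a₁ x ^ 2) (hI0 t ht) (by
      intro s hs
      have hs' := hmem t ht s hs
      have ha : a₁ s ≠ 0 := (ha_pos s hs').ne'
      refine ((hc_diff s hs').hasDerivAt.div ((ha_diff s hs').hasDerivAt.pow 2)
        (pow_ne_zero 2 ha)).congr_deriv ?_
      have hd : deriv a₁ s = c / a₁ s := by
        rw [eq_div_iff ha, mul_comm, hode_a s hs']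
      have hn : a₁ s ^ 2 - 2 * c * s ≠ 0 := sub_ne_zero.2 (hne s hs')
      rw [hode_c s hs', hd]
      field_simp
      simp only [Pi.pow_apply]
      push_cast
      ring)
    simpa only [hB0] using h
  refine ⟨fun t ht => ?_, fun t ht => ?_, fun t ht => ?_⟩
  · rw [← hsq t ht, Real.sqrt_sq (ha_pos t ht).le]
  · rw [← hsq t ht, ← hquot t ht, div_mul_cancel₀ _ (pow_ne_zero 2 (ha_pos t ht).ne')]
  · rw [mul_div_assoc, hquot t ht, mul_div_assoc]
end
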